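/- Let $d\ge 1$, $T>0$ and $\nu>0$. There exists a constant $C>0$ such that for all integers $n\ge 2$ and $m\ge 1$: $\sup_{x\in Q}\int_0^{T}\int_Q \bigl|(G_d)^n(t,x,y)-(G_d)^{n,m}(t+T/m,x,y)\bigr|\, dy\, dt \le C\, m^{-1+\nu}$. -/

import Mathlib

open MeasureTheory

/-- `φ_j(ξ) = √2 sin(jπξ)`. -/
noncomputable def phiF (j : ℕ) (ξ : ℝ) : ℝ := Real.sqrt 2 * Real.sin ((j : ℝ) * Real.pi * ξ)

/-- Green function of the heat operator on `[0,1]` with homogeneous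
Dirichlet boundary conditions: `G(t,x,y) = ∑_{j≥1} e^{-j²π²t} φ_j(x) φ_j(y)`. -/
noncomputable def G (t x y : ℝ) : ℝ :=
  ∑' j : ℕ, Real.exp (-((j : ℝ) + 1) ^ 2 * Real.pi ^ 2 * t) * phiF (j + 1) x * phiF (j + 1) y

/-- The cube `Q = [0,1]^d`. -/
def Q (d : ℕ) : Set (EuclideanSpace ℝ (Fin d)) := {x | ∀ i, x i ∈ Set.Icc (0 : ℝ) 1}

/-- `G_d(t,x,y) = ∏_i G(t,x_i,y_i)` on `Q = [0,1]^d`. -/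
noncomputable def Gd (d : ℕ) (t : ℝ) (x y : EuclideanSpace ℝ (Fin d)) : ℝ :=
  ∏ i, G t (x i) (y i)

/-- `‖φ‖_{(α)}² = ∫_Q ∫_Q |φ(y)| |y-z|^{-α} |φ(z)| dy dz`. -/
noncomputable def normAlphaSq (d : ℕ) (α : ℝ) (f : EuclideanSpace ℝ (Fin d) → ℝ) : ℝ :=
  ∫ y in Q d, ∫ z in Q d, |f y| * ‖y - z‖ ^ (-α) * |f z|

/-- `κ_n(y) = ⌊ny⌋/n`. -/
noncomputable def kappa (n : ℕ) (y : ℝ) : ℝ := (⌊(n : ℝ) * y⌋ : ℝ) / n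

/-- `λ_j^n = -4n² sin²(jπ/(2n))`. -/
noncomputable def lamn (n j : ℕ) : ℝ :=
  -4 * (n : ℝ) ^ 2 * Real.sin ((j : ℝ) * Real.pi / (2 * n)) ^ 2

/-- Piecewise-linear interpolation of `φ_j` on the grid `{i/n : 0 ≤ i ≤ n}`. -/
noncomputable def phiLin (n j : ℕ) (x : ℝ) : ℝ :=
  phiF j ((⌊(n : ℝ) * x⌋ : ℝ) / n) +
    ((n : ℝ) * x - (⌊(n : ℝ) * x⌋ : ℝ)) *
      (phiF j (((⌊(n : ℝ) * x⌋ : ℝ) + 1) / n) - phiF j ((⌊(n : ℝ) * x⌋ : ℝ) / n))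

/-- Space-discretized Green function on `[0,1]`:
`G^n(t,x,y) = ∑_{j=1}^{n-1} e^{λ_j^n t} φ_j^n(x) φ_j(κ_n(y))`. -/
noncomputable def Gn (n : ℕ) (t x y : ℝ) : ℝ :=
  ∑ j ∈ Finset.Icc 1 (n - 1), Real.exp (lamn n j * t) * phiLin n j x * phiF j (kappa n y)

/-- `(G_d)^n(t,x,y) = ∏_i G^n(t,x_i,y_i)`. -/
noncomputable def Gdn (d n : ℕ) (t : ℝ) (x y : EuclideanSpace ℝ (Fin d)) : ℝ :=
  ∏ i, Gn n t (x i) (y i)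

/-- Implicit space-time discretized Green function
`(G_d)^{n,m}(t,x,y) = ∑_{k ∈ {1,…,n-1}^d} (1 - (T/m) λ_k^n)^{-⌊mt/T⌋} φ_k^n(x) φ_k(κ_n(y))`. -/
noncomputable def Gdnm (d : ℕ) (T : ℝ) (n m : ℕ) (t : ℝ)
    (x y : EuclideanSpace ℝ (Fin d)) : ℝ :=
  ∑ k ∈ Finset.Icc (fun _ : Fin d => 1) (fun _ : Fin d => n - 1),
    (1 - T / (m : ℝ) * ∑ i, lamn n (k i)) ^ (-⌊(m : ℝ) * t / T⌋) *
      (∏ i, phiLin n (k i) (x i)) * ∏ i, phiF (k i) (kappa n (y i))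

section PartAlg
set_option linter.unusedSectionVars false
variable {B : Type*} [NormedRing B] [NormedAlgebra ℝ B] [CompleteSpace B] [NormOneClass B]

theorem hs_exp (x : B) : HasSum (fun k : ℕ => ((k.factorial : ℝ))⁻¹ • x ^ k) (NormedSpace.exp x) :=
  NormedSpace.exp_series_hasSum_exp' x

theorem hs_exp_real (t : ℝ) :
    HasSum (fun k : ℕ => t ^ k / (k.factorial : ℝ)) (Real.exp t) := by
  have := hs_exp (B := ℝ) t
  rw [← Real.exp_eq_exp_ℝ] at this
  refine this.congr_fun ?_ |> fun h => h
  intro k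
  simp [div_eq_inv_mul]

theorem hs_exp_real1 (t : ℝ) :
    HasSum (fun k : ℕ => t ^ k / (k.factorial : ℝ) * k) (t * Real.exp t) := by
  rw [← hasSum_nat_add_iff' 1]
  simp only [Finset.range_one, Finset.sum_singleton, Nat.cast_zero, mul_zero, sub_zero]
  refine ((hs_exp_real t).mul_left t).congr_fun ?_
  intro k
  have : ((k + 1 : ℕ).factorial : ℝ) = (k + 1) * k.factorial := by
    push_cast [Nat.factorial_succ]; ring
  have h2 : (k.factorial : ℝ) ≠ 0 := by positivity
  have h3 : (k + 1 : ℝ) ≠ 0 := by positivity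
  rw [this]; push_cast; field_simp; ring

theorem hs_exp_real2 (t : ℝ) :
    HasSum (fun k : ℕ => t ^ k / (k.factorial : ℝ) * k ^ 2) ((t ^ 2 + t) * Real.exp t) := by
  rw [← hasSum_nat_add_iff' 1]
  simp only [Finset.range_one, Finset.sum_singleton, Nat.cast_zero]
  have h := (((hs_exp_real1 t).add (hs_exp_real t)).mul_left t)
  have e : t * (t * Real.exp t + Real.exp t) = (t ^ 2 + t) * Real.exp t -
      t ^ 0 / ((Nat.factorial 0 : ℕ) : ℝ) * 0 ^ 2 := by simp; ring
  rw [e] at h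
  refine h.congr_fun ?_
  intro k
  have : ((k + 1 : ℕ).factorial : ℝ) = (k + 1) * k.factorial := by
    push_cast [Nat.factorial_succ]; ring
  have h2 : (k.factorial : ℝ) ≠ 0 := by positivity
  have h3 : (k + 1 : ℝ) ≠ 0 := by positivity
  rw [this]; push_cast; field_simp; ring

theorem norm_exp_le_aux (x : B) : ‖NormedSpace.exp x‖ ≤ Real.exp ‖x‖ := by
  rw [← (hs_exp x).tsum_eq]
  refine tsum_of_norm_bounded (hs_exp_real ‖x‖) ?_
  intro k
  rw [norm_smul, norm_inv, Real.norm_natCast, div_eq_inv_mul]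
  gcongr
  exact norm_pow_le x k

theorem exp_add_aux {x y : B} (h : Commute x y) :
    NormedSpace.exp (x + y) = NormedSpace.exp x * NormedSpace.exp y := by
  let _ : NormedAlgebra ℚ B := NormedAlgebra.restrictScalars ℚ ℝ B
  exact NormedSpace.exp_add_of_commute h

theorem exp_smul_one (c : ℝ) : NormedSpace.exp (c • (1 : B)) = Real.exp c • (1 : B) := by
  have h := hs_exp (c • (1 : B))
  have h2 := (hs_exp_real c).smul_const (1 : B)
  refine h.unique (h2.congr_fun ?_)
  intro k
  rw [smul_pow, one_pow, smul_smul, div_eq_inv_mul]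

theorem exp_sub_smul_one (x : B) (c : ℝ) :
    NormedSpace.exp (x - c • (1 : B)) = Real.exp (-c) • NormedSpace.exp x := by
  have : Commute x ((-c) • (1 : B)) := (Commute.one_right x).smul_right _
  rw [sub_eq_add_neg, ← neg_smul, exp_add_aux this, exp_smul_one]
  simp

theorem norm_exp_sub_le (x : B) (c : ℝ) (h : ‖x‖ ≤ c) :
    ‖NormedSpace.exp (x - c • (1 : B))‖ ≤ 1 := by
  rw [exp_sub_smul_one, norm_smul, Real.norm_of_nonneg (Real.exp_pos _).le]
  calc _ ≤ Real.exp (-c) * Real.exp ‖x‖ := by gcongr; exact norm_exp_le_aux x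
    _ = Real.exp (-c + ‖x‖) := (Real.exp_add _ _).symm
    _ ≤ 1 := by rw [Real.exp_le_one_iff]; linarith

theorem hs_diff (σ : B) (t : ℝ) (ht : 0 < t) :
    HasSum (fun k : ℕ => (t ^ k / (k.factorial : ℝ) * (k / t - 1)) • σ ^ k)
      ((σ - 1) * NormedSpace.exp (t • σ)) := by
  have h := hs_exp (t • σ)
  have h1 : HasSum (fun k : ℕ => (t ^ k / (k.factorial : ℝ) * (k / t)) • σ ^ k)
      (σ * NormedSpace.exp (t • σ)) := by
    rw [← hasSum_nat_add_iff' 1]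
    simp only [Finset.range_one, Finset.sum_singleton, Nat.cast_zero, zero_div, mul_zero, sub_zero,
      zero_smul]
    refine (h.mul_left σ).congr_fun ?_
    intro k
    have : ((k + 1 : ℕ).factorial : ℝ) = (k + 1) * k.factorial := by
      push_cast [Nat.factorial_succ]; ring
    have h2 : (k.factorial : ℝ) ≠ 0 := by positivity
    have h3 : (k + 1 : ℝ) ≠ 0 := by positivity
    rw [smul_pow, smul_smul, mul_smul_comm, ← pow_succ', this]
    congr 1
    push_cast; field_simp; ring
  have h3 := h1.sub h
  rw [sub_mul, one_mul]
  refine h3.congr_fun ?_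
  intro k
  rw [smul_pow, smul_smul, ← sub_smul]
  congr 1
  ring

theorem norm_diff_le (σ : B) (hσ : ‖σ‖ ≤ 1) (t : ℝ) (ht : 0 < t) :
    ‖(σ - 1) * NormedSpace.exp (t • (σ - 1))‖ ≤ 1 / Real.sqrt t := by
  have hst : 0 < Real.sqrt t := Real.sqrt_pos.2 ht
  have hsq : Real.sqrt t * Real.sqrt t = t := Real.mul_self_sqrt ht.le
  have e1 : t • (σ - 1) = t • σ - t • (1 : B) := smul_sub _ _ _
  rw [e1, exp_sub_smul_one, mul_smul_comm, norm_smul, Real.norm_of_nonneg (Real.exp_pos _).le,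
    ← (hs_diff σ t ht).tsum_eq]
  have key : HasSum (fun k : ℕ => (Real.sqrt t / 2 / t ^ 2) * (t ^ k / (k.factorial : ℝ) * k ^ 2)
      - (Real.sqrt t / t) * (t ^ k / (k.factorial : ℝ) * k)
      + (Real.sqrt t / 2 + 1 / (2 * Real.sqrt t)) * (t ^ k / (k.factorial : ℝ)))
      ((1 / Real.sqrt t) * Real.exp t) := by
    have := (((hs_exp_real2 t).mul_left (Real.sqrt t / 2 / t ^ 2)).sub
      ((hs_exp_real1 t).mul_left (Real.sqrt t / t))).add
      ((hs_exp_real t).mul_left (Real.sqrt t / 2 + 1 / (2 * Real.sqrt t)))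
    have h2 : Real.sqrt t ^ 2 = t := Real.sq_sqrt ht.le
    have e : (1 / Real.sqrt t) * Real.exp t =
        Real.sqrt t / 2 / t ^ 2 * ((t ^ 2 + t) * Real.exp t) - Real.sqrt t / t * (t * Real.exp t)
        + (Real.sqrt t / 2 + 1 / (2 * Real.sqrt t)) * Real.exp t := by
      field_simp
      rw [h2]; ring
    rw [e]
    exact this
  have hb : ‖∑' k : ℕ, (t ^ k / (k.factorial : ℝ) * (k / t - 1)) • σ ^ k‖
      ≤ (1 / Real.sqrt t) * Real.exp t := by
    refine tsum_of_norm_bounded key ?_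
    intro k
    have hp : ‖σ ^ k‖ ≤ 1 := (norm_pow_le σ k).trans (pow_le_one₀ (norm_nonneg _) hσ)
    have hA : 0 ≤ t ^ k / (k.factorial : ℝ) := by positivity
    rw [norm_smul, norm_mul, Real.norm_of_nonneg hA, Real.norm_eq_abs]
    have h4 : |(k : ℝ) / t - 1| ≤
        Real.sqrt t / 2 * (k / t - 1) ^ 2 + 1 / (2 * Real.sqrt t) := by
      have h5 : (0:ℝ) ≤ (Real.sqrt t * |(k : ℝ) / t - 1| - 1) ^ 2 / (2 * Real.sqrt t) := by
        positivity
      have h6 : (Real.sqrt t * |(k : ℝ) / t - 1| - 1) ^ 2 / (2 * Real.sqrt t) =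
        Real.sqrt t / 2 * |(k : ℝ) / t - 1| ^ 2 + 1 / (2 * Real.sqrt t) - |(k : ℝ) / t - 1| := by
        field_simp; ring
      rw [sq_abs] at h6
      linarith
    calc _ ≤ (t ^ k / (k.factorial : ℝ) *
          (Real.sqrt t / 2 * (k / t - 1) ^ 2 + 1 / (2 * Real.sqrt t))) * 1 := by gcongr
      _ = _ := by field_simp; ring
  calc _ ≤ Real.exp (-t) * ((1 / Real.sqrt t) * Real.exp t) := by gcongr
    _ = 1 / Real.sqrt t * (Real.exp (-t) * Real.exp t) := by ring
    _ = _ := by rw [← Real.exp_add]; simp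

variable {ι : Type*} [Fintype ι] [DecidableEq ι]

/-- generator -/
noncomputable def genA (N : ℝ) (σ τ : ι → B) : B := N • ∑ i, (σ i + τ i - (2 : ℝ) • (1 : B))


theorem norm_exp_genA (N : ℝ) (hN : 0 ≤ N) (σ τ : ι → B) (hσ : ∀ i, ‖σ i‖ ≤ 1)
    (hτ : ∀ i, ‖τ i‖ ≤ 1) (S : Finset ι) :
    ‖NormedSpace.exp (N • ∑ i ∈ S, (σ i + τ i - (2 : ℝ) • (1 : B)))‖ ≤ 1 := by
  have : N • ∑ i ∈ S, (σ i + τ i - (2 : ℝ) • (1 : B)) =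
      N • ∑ i ∈ S, (σ i + τ i) - (N * (S.card * 2)) • (1 : B) := by
    rw [Finset.sum_sub_distrib, smul_sub, Finset.sum_const, ← Nat.cast_smul_eq_nsmul ℝ, smul_smul,
      smul_smul]
    congr 2
    ring
  rw [this]
  apply norm_exp_sub_le
  rw [norm_smul, Real.norm_of_nonneg hN]
  gcongr
  calc _ ≤ ∑ i ∈ S, ‖σ i + τ i‖ := norm_sum_le _ _
    _ ≤ ∑ i ∈ S, (2:ℝ) := by
      gcongr with i hi
      have := norm_add_le (σ i) (τ i)
      linarith [hσ i, hτ i]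
    _ = _ := by simp

theorem norm_genA_exp (N : ℝ) (hN : 0 < N) (σ τ : ι → B) (hσ : ∀ i, ‖σ i‖ ≤ 1)
    (hτ : ∀ i, ‖τ i‖ ≤ 1) (hσσ : ∀ i j, Commute (σ i) (σ j))
    (hττ : ∀ i j, Commute (τ i) (τ j)) (hστ : ∀ i j, Commute (σ i) (τ j))
    (hinv : ∀ i, σ i * τ i = 1) :
    ‖genA N σ τ * NormedSpace.exp (genA N σ τ)‖ ≤ Fintype.card ι := by
  have h1 : ∀ i, ‖(σ i + τ i - (2 : ℝ) • (1 : B)) * NormedSpace.exp (genA N σ τ)‖ ≤ 1 / N := by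
    intro i
    set R := N • ∑ j ∈ Finset.univ.erase i, (σ j + τ j - (2 : ℝ) • (1 : B)) with hR
    have hc1 : ∀ x : B, (∀ j, Commute x (σ j)) → (∀ j, Commute x (τ j)) → Commute x R := by
      intro x h1 h2
      refine Commute.smul_right (Commute.sum_right _ _ _ fun j _ => ?_) _
      exact ((h1 j).add_right (h2 j)).sub_right ((Commute.one_right x).smul_right _)
    have hs : genA N σ τ = N • (σ i - 1) + (N • (τ i - 1) + R) := by
      have e0 : σ i + τ i - (2 : ℝ) • (1 : B) = (σ i - 1) + (τ i - 1) := by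
        rw [two_smul]; abel
      rw [genA, ← Finset.add_sum_erase _ _ (Finset.mem_univ i), smul_add, ← hR, e0, smul_add,
        add_assoc]
    have c1 : Commute (N • (τ i - 1)) R := by
      refine (Commute.smul_left ?_ _)
      refine Commute.sub_left (hc1 _ (fun j => (hστ j i).symm) (fun j => hττ i j))
        (Commute.one_left _)
    have c3 : Commute (σ i - 1) (τ i - 1) :=
      ((hστ i i).sub_right (Commute.one_right _)).sub_left (Commute.one_left _)
    have c2 : Commute (N • (σ i - 1)) (N • (τ i - 1) + R) := by
      refine (Commute.smul_left ?_ _)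
      refine Commute.add_right (c3.smul_right _) ?_
      refine Commute.sub_left (hc1 _ (fun j => hσσ i j) (fun j => hστ i j))
        (Commute.one_left _)
    have c4 : Commute (τ i - 1) (NormedSpace.exp (N • (σ i - 1))) := by
      let _ : NormedAlgebra ℚ B := NormedAlgebra.restrictScalars ℚ ℝ B
      exact (c3.symm.smul_right N).exp_right
    rw [hs, exp_add_aux c2, exp_add_aux c1]
    have hf : σ i + τ i - (2 : ℝ) • (1 : B) = -((σ i - 1) * (τ i - 1)) := by
      rw [two_smul, sub_mul, mul_sub, hinv]; simp only [mul_one, one_mul]; abel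
    have e : (σ i + τ i - (2 : ℝ) • (1 : B)) * (NormedSpace.exp (N • (σ i - 1)) *
        (NormedSpace.exp (N • (τ i - 1)) * NormedSpace.exp R)) =
        -(((σ i - 1) * NormedSpace.exp (N • (σ i - 1))) *
          ((τ i - 1) * NormedSpace.exp (N • (τ i - 1))) * NormedSpace.exp R) := by
      rw [hf, neg_mul]
      congr 1
      calc _ = (σ i - 1) * ((τ i - 1) * NormedSpace.exp (N • (σ i - 1))) *
          (NormedSpace.exp (N • (τ i - 1)) * NormedSpace.exp R) := by simp only [mul_assoc]
        _ = _ := by rw [c4.eq]; simp only [mul_assoc]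
    rw [e, norm_neg]
    calc _ ≤ ‖(σ i - 1) * NormedSpace.exp (N • (σ i - 1))‖ *
          ‖(τ i - 1) * NormedSpace.exp (N • (τ i - 1))‖ * ‖NormedSpace.exp R‖ :=
          (norm_mul_le _ _).trans (by gcongr; exact norm_mul_le _ _)
      _ ≤ (1 / Real.sqrt N) * (1 / Real.sqrt N) * 1 := by
          gcongr
          · exact norm_diff_le _ (hσ i) N hN
          · exact norm_diff_le _ (hτ i) N hN
          · exact norm_exp_genA N hN.le σ τ hσ hτ _
      _ = 1 / N := by
          rw [mul_one, div_mul_div_comm, Real.mul_self_sqrt hN.le, one_mul]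
  have e2 : genA N σ τ * NormedSpace.exp (genA N σ τ) =
      N • ∑ i, (σ i + τ i - (2 : ℝ) • (1 : B)) * NormedSpace.exp (genA N σ τ) := by
    rw [← Finset.sum_mul, ← smul_mul_assoc]; rfl
  rw [e2, norm_smul, Real.norm_of_nonneg hN.le]
  calc _ ≤ N * ∑ i : ι, (1 / N) := by
        gcongr
        exact (norm_sum_le _ _).trans (Finset.sum_le_sum fun i _ => h1 i)
    _ = _ := by simp; field_simp

theorem norm_genA_sq_exp (N : ℝ) (hN : 0 < N) (σ τ : ι → B) (hσ : ∀ i, ‖σ i‖ ≤ 1)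
    (hτ : ∀ i, ‖τ i‖ ≤ 1) (hσσ : ∀ i j, Commute (σ i) (σ j))
    (hττ : ∀ i j, Commute (τ i) (τ j)) (hστ : ∀ i j, Commute (σ i) (τ j))
    (hinv : ∀ i, σ i * τ i = 1) :
    ‖genA N σ τ * (genA N σ τ * NormedSpace.exp (genA N σ τ))‖ ≤ 4 * (Fintype.card ι : ℝ) ^ 2 := by
  have hh := norm_genA_exp (N / 2) (by positivity) σ τ hσ hτ hσσ hττ hστ hinv
  set A := genA (N / 2) σ τ with hA
  have e : genA N σ τ = A + A := by
    rw [hA, genA, genA, ← add_smul]; congr 1; ring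
  have c : Commute A (NormedSpace.exp A) := by
    let _ : NormedAlgebra ℚ B := NormedAlgebra.restrictScalars ℚ ℝ B
    exact (Commute.refl A).exp_right
  have e2 : (A + A) * ((A + A) * NormedSpace.exp (A + A)) =
      (4 : ℝ) • ((A * NormedSpace.exp A) * (A * NormedSpace.exp A)) := by
    rw [exp_add_aux (Commute.refl A), ← two_smul ℝ A]
    simp only [smul_mul_assoc, mul_smul_comm, smul_smul]
    congr 1
    · norm_num
    · simp only [mul_assoc]
      rw [← mul_assoc (NormedSpace.exp A) A, ← c.eq, mul_assoc]
  rw [e, e2, norm_smul]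
  have : ‖(A * NormedSpace.exp A) * (A * NormedSpace.exp A)‖ ≤ (Fintype.card ι : ℝ) ^ 2 := by
    rw [sq]
    exact (norm_mul_le _ _).trans (mul_le_mul hh hh (norm_nonneg _) (by positivity))
  simp only [Real.norm_ofNat]
  gcongr

end PartAlg

section PartScalar

theorem gam_int (q : ℕ) (r : ℝ) (hr : 0 < r) :
    IntegrableOn (fun s : ℝ => s ^ q * Real.exp (-(r * s))) (Set.Ioi 0) ∧
    ∫ s in Set.Ioi (0:ℝ), s ^ q * Real.exp (-(r * s)) = q.factorial / r ^ (q + 1) := by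
  have h := Real.integral_rpow_mul_exp_neg_mul_Ioi (a := (q : ℝ) + 1) (r := r) (by positivity) hr
  have h2 : ∫ s in Set.Ioi (0:ℝ), s ^ q * Real.exp (-(r * s)) = q.factorial / r ^ (q + 1) := by
    rw [Real.Gamma_nat_eq_factorial] at h
    have e : (1 / r) ^ ((q : ℝ) + 1) = 1 / r ^ (q + 1) := by
      rw [← Nat.cast_succ, Real.rpow_natCast, one_div_pow]
    rw [e] at h
    simp only [add_sub_cancel_right, Real.rpow_natCast] at h
    rw [h]; ring
  refine ⟨?_, h2⟩
  apply MeasureTheory.Integrable.of_integral_ne_zero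
  rw [h2]
  positivity

theorem taylor_aux (g g1 g2 : ℝ → ℝ) (h1 : ∀ s, HasDerivAt g (g1 s) s)
    (h2 : ∀ s, HasDerivAt g1 (g2 s) s) (u s M : ℝ)
    (hM : ∀ v ∈ Set.uIcc u s, |g2 v| ≤ M) :
    |g s - g u - (s - u) * g1 u| ≤ M * (s - u) ^ 2 := by
  have hM0 : 0 ≤ M := (abs_nonneg _).trans (hM u Set.left_mem_uIcc)
  have a1 : ∀ v ∈ Set.uIcc u s, ‖g1 v - g1 u‖ ≤ M * |s - u| := by
    intro v hv
    have := Convex.norm_image_sub_le_of_norm_hasDerivWithin_le (f := g1) (f' := g2)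
      (s := Set.uIcc u s) (x := u) (y := v) (C := M) (fun x _ => (h2 x).hasDerivWithinAt)
      hM (convex_uIcc u s) Set.left_mem_uIcc hv
    refine this.trans ?_
    gcongr
    exact Set.abs_sub_left_of_mem_uIcc hv
  have := Convex.norm_image_sub_le_of_norm_hasDerivWithin_le (f := fun v => g v - v * g1 u)
    (f' := fun v => g1 v - g1 u)
      (s := Set.uIcc u s) (x := u) (y := s) (C := M * |s - u|)
      (fun x _ => ((h1 x).sub (by simpa using (hasDerivAt_id x).mul_const (g1 u))).hasDerivWithinAt)
      a1 (convex_uIcc u s) Set.left_mem_uIcc Set.right_mem_uIcc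
  have e : g s - g u - (s - u) * g1 u = (g s - s * g1 u) - (g u - u * g1 u) := by ring
  rw [e]
  refine this.trans (le_of_eq ?_)
  rw [Real.norm_eq_abs, mul_assoc, abs_mul_abs_self]; ring

theorem taylor_global (g g1 g2 : ℝ → ℝ) (h1 : ∀ s, HasDerivAt g (g1 s) s)
    (h2 : ∀ s, HasDerivAt g1 (g2 s) s) (D E : ℝ) (hD : 0 ≤ D) (hE : 0 ≤ E)
    (b0 : ∀ s, 0 < s → |g s| ≤ 1) (b1 : ∀ s, 0 < s → |g1 s| ≤ D / s)
    (b2 : ∀ s, 0 < s → |g2 s| ≤ E / s ^ 2) (p s : ℝ) (hp : 0 < p) (hs : 0 < s) :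
    |g s - g p - (s - p) * g1 p| ≤ (4 * E + 8 + 4 * D) / p ^ 2 * (s - p) ^ 2 := by
  rcases le_total (p / 2) s with h | h
  · have := taylor_aux g g1 g2 h1 h2 p s (4 * E / p ^ 2) (by
      intro v hv
      have hv2 : p / 2 ≤ v := by
        have := hv.1
        refine le_trans ?_ this
        exact le_min (by linarith) h
      refine (b2 v (by linarith)).trans ?_
      rw [div_le_div_iff₀ (by nlinarith) (by positivity)]
      have : p ^ 2 ≤ 4 * v ^ 2 := by nlinarith
      nlinarith)
    refine this.trans ?_
    gcongr
    linarith
  · have q1 : |g s - g p - (s - p) * g1 p| ≤ 2 + D := by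
      have e1 : |(s - p) * g1 p| ≤ D := by
        rw [abs_mul]
        calc _ ≤ p * (D / p) := by
              gcongr
              · rw [abs_le]; constructor <;> linarith
              · exact b1 p hp
          _ = D := by field_simp
      have := b0 s hs
      have := b0 p hp
      calc _ ≤ |g s - g p| + |(s - p) * g1 p| := abs_sub _ _
        _ ≤ |g s| + |g p| + |(s - p) * g1 p| := by gcongr; exact abs_sub _ _
        _ ≤ _ := by linarith
    refine q1.trans ?_
    have q2 : p ^ 2 ≤ 4 * (s - p) ^ 2 := by nlinarith
    rw [div_mul_eq_mul_div, le_div_iff₀ (by positivity)]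
    nlinarith [mul_nonneg hE (sq_nonneg (s-p)), mul_nonneg hD (sub_nonneg.2 q2)]

theorem scalar_main {κ : Type*} (S : Finset κ) (a μ : κ → ℝ) (hμ : ∀ k ∈ S, μ k ≤ 0) (D E : ℝ)
    (hD : 0 ≤ D) (hE : 0 ≤ E)
    (b0 : ∀ s, 0 < s → |∑ k ∈ S, a k * Real.exp (μ k * s)| ≤ 1)
    (b1 : ∀ s, 0 < s → |∑ k ∈ S, a k * (μ k * Real.exp (μ k * s))| ≤ D / s)
    (b2 : ∀ s, 0 < s → |∑ k ∈ S, a k * (μ k * (μ k * Real.exp (μ k * s)))| ≤ E / s ^ 2)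
    (q : ℕ) (t : ℝ) (ht : 0 < t) (ht1 : (q : ℝ) ≤ t) (ht2 : t ≤ q + 1) :
    |∑ k ∈ S, a k * (Real.exp (μ k * t) - ((1 - μ k) ^ (q + 1))⁻¹)|
      ≤ (D + 2 * (4 * E + 8 + 4 * D)) / (q + 1) := by
  set g : ℝ → ℝ := fun s => ∑ k ∈ S, a k * Real.exp (μ k * s) with hg
  set g1 : ℝ → ℝ := fun s => ∑ k ∈ S, a k * (μ k * Real.exp (μ k * s)) with hg1
  set g2 : ℝ → ℝ := fun s => ∑ k ∈ S, a k * (μ k * (μ k * Real.exp (μ k * s))) with hg2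
  have hexp : ∀ k s, HasDerivAt (fun s => Real.exp (μ k * s)) (μ k * Real.exp (μ k * s)) s := by
    intro k s
    have := ((hasDerivAt_id s).const_mul (μ k)).exp
    simpa [mul_comm] using this
  have d1 : ∀ s, HasDerivAt g (g1 s) s := fun s =>
    HasDerivAt.fun_sum fun k _ => (hexp k s).const_mul (a k)
  have d2 : ∀ s, HasDerivAt g1 (g2 s) s := fun s =>
    HasDerivAt.fun_sum fun k _ => ((hexp k s).const_mul (μ k)).const_mul (a k)
  set p : ℝ := (q : ℝ) + 1 with hp
  have hp1 : 1 ≤ p := by rw [hp]; linarith [(Nat.cast_nonneg q : (0:ℝ) ≤ q)]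
  have hp0 : 0 < p := by linarith
  set C := 4 * E + 8 + 4 * D with hC
  have hC0 : 0 ≤ C := by positivity
  have tay : ∀ s, 0 < s → |g s - g p - (s - p) * g1 p| ≤ C / p ^ 2 * (s - p) ^ 2 := fun s hs =>
    taylor_global g g1 g2 d1 d2 D E hD hE b0 b1 b2 p s hp0 hs
  -- first part
  have r1 : |g t - g p| ≤ (D + C) / p := by
    have e1 := tay t ht
    have e2 : |(t - p) * g1 p| ≤ D / p := by
      rw [abs_mul]
      calc _ ≤ 1 * (D / p) := by
            gcongr
            · rw [abs_le]; constructor <;> linarith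
            · exact b1 p hp0
        _ = _ := one_mul _
    have e3 : C / p ^ 2 * (t - p) ^ 2 ≤ C / p := by
      calc _ ≤ C / p ^ 2 * 1 := by
            gcongr
            nlinarith
        _ ≤ C / p := by
            rw [mul_one]
            gcongr
            nlinarith
    calc |g t - g p| = |(g t - g p - (t - p) * g1 p) + (t - p) * g1 p| := by congr 1; ring
      _ ≤ _ := abs_add_le _ _
      _ ≤ C / p + D / p := by linarith
      _ = _ := by ring
  -- second part
  have hf0 : (0:ℝ) < q.factorial := by positivity
  set w : ℝ → ℝ := fun s => s ^ q * Real.exp (-(1 * s)) / q.factorial with hw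
  have m0 := gam_int q 1 one_pos
  have m1 := gam_int (q + 1) 1 one_pos
  have m2 := gam_int (q + 2) 1 one_pos
  have f1 : ((q + 1 : ℕ).factorial : ℝ) = p * q.factorial := by
    push_cast [Nat.factorial_succ]; ring
  have f2 : ((q + 2 : ℕ).factorial : ℝ) = (p + 1) * (p * q.factorial) := by
    rw [← f1, Nat.factorial_succ]; push_cast; ring
  have wi : IntegrableOn w (Set.Ioi 0) := m0.1.div_const _
  have w0 : ∫ s in Set.Ioi (0:ℝ), w s = 1 := by
    rw [hw, integral_div, m0.2]; field_simp; simp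
  have w1i : IntegrableOn (fun s => w s * (s - p)) (Set.Ioi 0) := by
    refine ((m1.1.div_const (q.factorial : ℝ)).sub (wi.mul_const p)).congr (ae_of_all _ fun s => ?_)
    simp only [hw, Pi.sub_apply]; ring
  have w1 : ∫ s in Set.Ioi (0:ℝ), w s * (s - p) = 0 := by
    have : ∫ s in Set.Ioi (0:ℝ), w s * (s - p) = ∫ s in Set.Ioi (0:ℝ),
      ((s ^ (q + 1) * Real.exp (-(1 * s)) / q.factorial) - w s * p) := by
      congr 1; ext s; simp only [hw]; ring
    rw [this, integral_sub (m1.1.div_const (q.factorial : ℝ)) (wi.mul_const p), integral_div,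
      integral_mul_const, w0, m1.2, f1]
    field_simp; simp
  have w2i : IntegrableOn (fun s => w s * (s - p) ^ 2) (Set.Ioi 0) := by
    refine ((m2.1.div_const (q.factorial : ℝ)).sub ((w1i.mul_const (2 * p)).add
      (wi.mul_const (p ^ 2)))).congr (ae_of_all _ fun s => ?_)
    simp only [hw, Pi.sub_apply, Pi.add_apply]; ring
  have w2 : ∫ s in Set.Ioi (0:ℝ), w s * (s - p) ^ 2 = p := by
    have : ∫ s in Set.Ioi (0:ℝ), w s * (s - p) ^ 2 = ∫ s in Set.Ioi (0:ℝ),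
      ((s ^ (q + 2) * Real.exp (-(1 * s)) / q.factorial) -
        (w s * (s - p) * (2 * p) + w s * p ^ 2)) := by
      congr 1; ext s; simp only [hw]; ring
    rw [this, integral_sub (m2.1.div_const (q.factorial : ℝ))
      (Integrable.fun_add (w1i.mul_const (2 * p)) (wi.mul_const (p ^ 2))),
      integral_add (w1i.mul_const (2 * p)) (wi.mul_const (p ^ 2)), integral_div,
      integral_mul_const, integral_mul_const, w0, w1, m2.2, f2]
    field_simp; simp
  have we : ∀ k ∈ S, IntegrableOn (fun s => w s * Real.exp (μ k * s)) (Set.Ioi 0) ∧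
      ∫ s in Set.Ioi (0:ℝ), w s * Real.exp (μ k * s) = ((1 - μ k) ^ (q + 1))⁻¹ := by
    intro k hk
    have hr : 0 < 1 - μ k := by linarith [hμ k hk]
    have m := gam_int q (1 - μ k) hr
    have ee : (fun s => w s * Real.exp (μ k * s)) =
        fun s => s ^ q * Real.exp (-((1 - μ k) * s)) / q.factorial := by
      ext s
      have : -((1 - μ k) * s) = -(1 * s) + μ k * s := by ring
      rw [this, Real.exp_add]; simp only [hw]; ring
    rw [ee]
    refine ⟨m.1.div_const _, ?_⟩
    rw [integral_div, m.2]
    field_simp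
  have wgi : IntegrableOn (fun s => w s * g s) (Set.Ioi 0) := by
    have : (fun s => w s * g s) = fun s => ∑ k ∈ S, a k * (w s * Real.exp (μ k * s)) := by
      ext s; rw [hg, Finset.mul_sum]; refine Finset.sum_congr rfl fun k _ => ?_; ring
    rw [this]
    exact integrable_finsetSum _ fun k hk => (we k hk).1.const_mul _
  have wg : ∫ s in Set.Ioi (0:ℝ), w s * g s = ∑ k ∈ S, a k * ((1 - μ k) ^ (q + 1))⁻¹ := by
    have : (fun s => w s * g s) = fun s => ∑ k ∈ S, a k * (w s * Real.exp (μ k * s)) := by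
      ext s; rw [hg, Finset.mul_sum]; refine Finset.sum_congr rfl fun k _ => ?_; ring
    rw [this, integral_finsetSum _ fun k hk => (we k hk).1.const_mul _]
    refine Finset.sum_congr rfl fun k hk => ?_
    rw [integral_const_mul, (we k hk).2]
  have r2 : |∑ k ∈ S, a k * ((1 - μ k) ^ (q + 1))⁻¹ - g p| ≤ C / p := by
    have e : ∑ k ∈ S, a k * ((1 - μ k) ^ (q + 1))⁻¹ - g p =
        ∫ s in Set.Ioi (0:ℝ), w s * (g s - g p - (s - p) * g1 p) := by
      have : (fun s => w s * (g s - g p - (s - p) * g1 p)) =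
        fun s => w s * g s - (w s * g p + w s * (s - p) * g1 p) := by ext s; ring
      rw [this, integral_sub wgi (Integrable.fun_add (wi.mul_const _) (w1i.mul_const _)),
        integral_add (wi.mul_const _) (w1i.mul_const _), integral_mul_const, integral_mul_const,
        w0, w1, wg]
      ring
    rw [e, ← Real.norm_eq_abs]
    calc _ ≤ ∫ s in Set.Ioi (0:ℝ), (w s * (s - p) ^ 2) * (C / p ^ 2) := by
          refine norm_integral_le_of_norm_le (w2i.mul_const _) ?_
          refine (ae_restrict_iff' measurableSet_Ioi).2 (ae_of_all _ fun s hs => ?_)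
          have hs0 : (0:ℝ) < s := hs
          have hwn : 0 ≤ w s := by simp only [hw]; positivity
          rw [norm_mul, Real.norm_of_nonneg hwn, mul_assoc]
          gcongr
          rw [mul_comm ((s - p) ^ 2)]
          exact tay s hs0
      _ = C / p := by rw [integral_mul_const, w2]; field_simp
  have e : ∑ k ∈ S, a k * (Real.exp (μ k * t) - ((1 - μ k) ^ (q + 1))⁻¹) =
      (g t - g p) - (∑ k ∈ S, a k * ((1 - μ k) ^ (q + 1))⁻¹ - g p) := by
    simp only [mul_sub, Finset.sum_sub_distrib, hg]; ring
  rw [e]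
  calc _ ≤ _ := abs_sub _ _
    _ ≤ (D + C) / p + C / p := add_le_add r1 r2
    _ = _ := by ring

end PartScalar

section PartLattice

/-- bounded functions on the lattice -/
abbrev LatE (d : ℕ) := BoundedContinuousFunction (Fin d → ℤ) ℝ

instance latNontriv (d : ℕ) : Nontrivial (LatE d) := by
  refine ⟨0, BoundedContinuousFunction.const _ 1, fun h => ?_⟩
  have := DFunLike.congr_fun h (fun _ => (0:ℤ))
  simp at this

theorem clmTopRing (E : Type*) [NormedAddCommGroup E] [NormedSpace ℝ E] :
    IsTopologicalRing (E →L[ℝ] E) := inferInstance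

instance latTopRing (d : ℕ) : IsTopologicalRing (LatE d →L[ℝ] LatE d) := clmTopRing _

/-- translation operator -/
noncomputable def shiftOp {d : ℕ} (v : Fin d → ℤ) : LatE d →L[ℝ] LatE d :=
  LinearMap.mkContinuous
    { toFun := fun f => f.compContinuous ⟨fun z => z + v, continuous_of_discreteTopology⟩
      map_add' := fun f g => by ext z; simp
      map_smul' := fun c f => by ext z; simp } 1 (by
    intro f
    rw [one_mul]
    refine (BoundedContinuousFunction.norm_le (norm_nonneg _)).2 fun z => ?_
    exact f.norm_coe_le_norm _)

theorem shiftOp_apply {d : ℕ} (v : Fin d → ℤ) (f : LatE d) (z : Fin d → ℤ) :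
    shiftOp v f z = f (z + v) := rfl

theorem shiftOp_norm {d : ℕ} (v : Fin d → ℤ) : ‖(shiftOp v : LatE d →L[ℝ] LatE d)‖ ≤ 1 :=
  LinearMap.mkContinuous_norm_le _ zero_le_one _

theorem shiftOp_mul {d : ℕ} (v w : Fin d → ℤ) :
    (shiftOp v : LatE d →L[ℝ] LatE d) * shiftOp w = shiftOp (v + w) := by
  ext f z
  rw [mul_apply_eq_comp, shiftOp_apply, shiftOp_apply, shiftOp_apply, add_assoc]

theorem shiftOp_comm {d : ℕ} (v w : Fin d → ℤ) :
    Commute (shiftOp v : LatE d →L[ℝ] LatE d) (shiftOp w) := by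
  rw [Commute, SemiconjBy, shiftOp_mul, shiftOp_mul, add_comm]

theorem shiftOp_inv {d : ℕ} (v : Fin d → ℤ) :
    (shiftOp v : LatE d →L[ℝ] LatE d) * shiftOp (-v) = 1 := by
  rw [shiftOp_mul, add_neg_cancel]
  ext f z
  rw [shiftOp_apply, add_zero]; rfl

theorem phiF_abs_le (j : ℕ) (ξ : ℝ) : |phiF j ξ| ≤ Real.sqrt 2 := by
  rw [phiF, abs_mul, abs_of_nonneg (Real.sqrt_nonneg _)]
  exact mul_le_of_le_one_right (Real.sqrt_nonneg _) (Real.abs_sin_le_one _)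

/-- lattice eigenfunction -/
noncomputable def psiL {d : ℕ} (n : ℕ) (k : Fin d → ℕ) : LatE d :=
  BoundedContinuousFunction.ofNormedAddCommGroupDiscrete
    (fun z => ∏ i, phiF (k i) ((z i : ℝ) / n)) (∏ _i : Fin d, Real.sqrt 2) (by
    intro z
    rw [norm_prod]
    exact Finset.prod_le_prod (fun i _ => norm_nonneg _) fun i _ => phiF_abs_le _ _)

theorem psiL_apply {d : ℕ} (n : ℕ) (k : Fin d → ℕ) (z : Fin d → ℤ) :
    psiL n k z = ∏ i, phiF (k i) ((z i : ℝ) / n) := rfl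

theorem lamn_eq (n j : ℕ) (hn : 0 < n) :
    lamn n j = (n : ℝ) ^ 2 * (2 * Real.cos (j * Real.pi / n) - 2) := by
  have h : (n : ℝ) ≠ 0 := by positivity
  have e : (j : ℝ) * Real.pi / n = 2 * (j * Real.pi / (2 * n)) := by field_simp
  rw [lamn, e, Real.cos_two_mul, Real.sin_sq]; ring

/-- forward shift -/
noncomputable def sgF (d : ℕ) (i : Fin d) : LatE d →L[ℝ] LatE d := shiftOp (Pi.single i 1)
/-- backward shift -/
noncomputable def sgB (d : ℕ) (i : Fin d) : LatE d →L[ℝ] LatE d := shiftOp (-Pi.single i 1)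

theorem phiF_add (j n : ℕ) (hn : 0 < n) (a : ℝ) :
    phiF j ((a + 1) / n) + phiF j ((a - 1) / n) =
      2 * Real.cos (j * Real.pi / n) * phiF j (a / n) := by
  have h : (n : ℝ) ≠ 0 := by positivity
  have e1 : (j : ℝ) * Real.pi * ((a + 1) / n) = j * Real.pi * (a / n) + j * Real.pi / n := by
    field_simp
  have e2 : (j : ℝ) * Real.pi * ((a - 1) / n) = j * Real.pi * (a / n) - j * Real.pi / n := by
    field_simp
  simp only [phiF]
  rw [e1, e2, Real.sin_add, Real.sin_sub]; ring

theorem psiL_shift {d : ℕ} (n : ℕ) (hn : 0 < n) (k : Fin d → ℕ) (i : Fin d) :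
    (sgF d i + sgB d i - (2 : ℝ) • (1 : LatE d →L[ℝ] LatE d)) (psiL n k) =
      (2 * Real.cos (k i * Real.pi / n) - 2) • psiL n k := by
  ext z
  have key : ∀ c : ℤ, psiL n k (z + Pi.single i c) =
      phiF (k i) (((z i : ℝ) + c) / n) * ∏ j ∈ Finset.univ.erase i, phiF (k j) ((z j : ℝ) / n) := by
    intro c
    rw [psiL_apply, ← Finset.mul_prod_erase _ _ (Finset.mem_univ i)]
    congr 1
    · simp
    · refine Finset.prod_congr rfl fun j hj => ?_
      have : j ≠ i := Finset.ne_of_mem_erase hj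
      simp [this]
  have k1 := key 1
  have k2 := key (-1)
  have k0 := key 0
  rw [Pi.single_neg] at k2
  rw [Pi.single_zero, add_zero] at k0
  have e : (sgF d i + sgB d i - (2 : ℝ) • (1 : LatE d →L[ℝ] LatE d)) (psiL n k) z =
    psiL n k (z + Pi.single i 1) + psiL n k (z + -Pi.single i 1) - 2 * psiL n k z := rfl
  have e2 : ((2 * Real.cos (k i * Real.pi / n) - 2) • psiL n k) z =
    (2 * Real.cos (k i * Real.pi / n) - 2) * psiL n k z := rfl
  rw [e, e2, k1, k2, k0]
  have := phiF_add (k i) n hn (z i)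
  push_cast
  rw [← sub_eq_add_neg, ← add_mul, this]
  simp only [add_zero]
  ring

theorem genA_psiL {d : ℕ} (n : ℕ) (hn : 0 < n) (k : Fin d → ℕ) (c : ℝ) :
    genA (c * (n : ℝ) ^ 2) (sgF d) (sgB d) (psiL n k) = (c * ∑ i, lamn n (k i)) • psiL n k := by
  rw [genA]
  rw [_root_.smul_apply, _root_.sum_apply]
  simp only [psiL_shift n hn]
  rw [← Finset.sum_smul, smul_smul, mul_assoc, Finset.mul_sum]
  simp only [lamn_eq n _ hn]

theorem exp_eig {d : ℕ} (A : LatE d →L[ℝ] LatE d) (v : LatE d) (c : ℝ) (h : A v = c • v) :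
    NormedSpace.exp A v = Real.exp c • v := by
  have h1 := (hs_exp A).mapL (ContinuousLinearMap.apply ℝ (LatE d) v)
  have h2 := (hs_exp_real c).smul_const v
  refine HasSum.unique h1 (h2.congr_fun ?_)
  intro k
  have hk : (A ^ k) v = c ^ k • v := by
    induction k with
    | zero => simp
    | succ k ih => rw [pow_succ', mul_apply_eq_comp, ih, map_smul, h, smul_smul,
        pow_succ]
  simp only [ContinuousLinearMap.apply_apply, _root_.smul_apply, hk, smul_smul]
  rw [div_eq_inv_mul]

theorem lattice_bounds {d : ℕ} (n : ℕ) (hn : 0 < n) (S : Finset (Fin d → ℕ)) (b : (Fin d → ℕ) → ℝ)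
    (hb : ∀ z : Fin d → ℤ, |∑ k ∈ S, b k * psiL n k z| ≤ 1) (L : LatE d →ₗ[ℝ] ℝ)
    (hL : ∀ F, |L F| ≤ ‖F‖) (h : ℝ) (hh : 0 < h) (s : ℝ) (hs : 0 < s) :
    |∑ k ∈ S, (b k * L (psiL n k)) * Real.exp ((h * ∑ i, lamn n (k i)) * s)| ≤ 1 ∧
    |∑ k ∈ S, (b k * L (psiL n k)) * ((h * ∑ i, lamn n (k i)) *
      Real.exp ((h * ∑ i, lamn n (k i)) * s))| ≤ d / s ∧
    |∑ k ∈ S, (b k * L (psiL n k)) * ((h * ∑ i, lamn n (k i)) * ((h * ∑ i, lamn n (k i)) *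
      Real.exp ((h * ∑ i, lamn n (k i)) * s)))| ≤ (4 * (d : ℝ) ^ 2) / s ^ 2 := by
  set f : LatE d := ∑ k ∈ S, b k • psiL n k with hf
  have hfn : ‖f‖ ≤ 1 := by
    refine (BoundedContinuousFunction.norm_le zero_le_one).2 fun z => ?_
    have : f z = ∑ k ∈ S, b k * psiL n k z := by
      rw [hf, BoundedContinuousFunction.sum_apply]; rfl
    rw [this]; exact hb z
  set N := (s * h) * (n : ℝ) ^ 2 with hN
  have hN0 : 0 < N := by positivity
  have c1 : ∀ i, ‖sgF d i‖ ≤ 1 := fun i => shiftOp_norm _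
  have c2 : ∀ i, ‖sgB d i‖ ≤ 1 := fun i => shiftOp_norm _
  have n0 := norm_exp_genA N hN0.le (sgF d) (sgB d) c1 c2 Finset.univ
  have n1 := norm_genA_exp N hN0 (sgF d) (sgB d) c1 c2 (fun i j => shiftOp_comm _ _)
    (fun i j => shiftOp_comm _ _) (fun i j => shiftOp_comm _ _) (fun i => shiftOp_inv _)
  have n2 := norm_genA_sq_exp N hN0 (sgF d) (sgB d) c1 c2 (fun i j => shiftOp_comm _ _)
    (fun i j => shiftOp_comm _ _) (fun i j => shiftOp_comm _ _) (fun i => shiftOp_inv _)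
  change ‖NormedSpace.exp (genA N (sgF d) (sgB d))‖ ≤ 1 at n0
  rw [Fintype.card_fin] at n1 n2
  set A := genA N (sgF d) (sgB d) with hA
  have eig : ∀ k, A (psiL n k) = (s * (h * ∑ i, lamn n (k i))) • psiL n k := by
    intro k
    rw [hA, hN, genA_psiL n hn k, mul_assoc]
  have eeig := fun k => exp_eig A (psiL n k) _ (eig k)
  have gen : ∀ (M : LatE d →L[ℝ] LatE d) (c : (Fin d → ℕ) → ℝ) (K : ℝ),
      (∀ k, M (psiL n k) = c k • psiL n k) → ‖M‖ ≤ K →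
      |∑ k ∈ S, (b k * L (psiL n k)) * c k| ≤ K := by
    intro M c K hM hK
    have e : ∑ k ∈ S, (b k * L (psiL n k)) * c k = L (M f) := by
      rw [hf, map_sum, map_sum]
      refine Finset.sum_congr rfl fun k _ => ?_
      rw [map_smul, hM, map_smul, map_smul, smul_eq_mul, smul_eq_mul]; ring
    rw [e]
    calc _ ≤ ‖M f‖ := hL _
      _ ≤ ‖M‖ * ‖f‖ := M.le_opNorm f
      _ ≤ ‖M‖ * 1 := by gcongr
      _ ≤ K := by rw [mul_one]; exact hK
  refine ⟨?_, ?_, ?_⟩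
  · have := gen _ _ 1 eeig n0
    convert this using 5
    ring
  · have := gen _ (fun k => Real.exp (s * (h * ∑ i, lamn n (k i))) *
      (s * (h * ∑ i, lamn n (k i)))) d (fun k => by
        rw [mul_apply_eq_comp, eeig, map_smul, eig, smul_smul]) n1
    rw [le_div_iff₀ hs, ← abs_of_pos hs, ← abs_mul, Finset.sum_mul, abs_of_pos hs]
    refine le_of_eq_of_le (congrArg _ (Finset.sum_congr rfl fun k _ => ?_)) this
    rw [mul_comm s]; ring
  · have := gen _ (fun k => Real.exp (s * (h * ∑ i, lamn n (k i))) *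
      (s * (h * ∑ i, lamn n (k i))) * (s * (h * ∑ i, lamn n (k i)))) _ (fun k => by
        rw [mul_apply_eq_comp, mul_apply_eq_comp, eeig, map_smul, eig,
          smul_smul, map_smul, eig, smul_smul]) n2
    have hs2 : 0 < s ^ 2 := by positivity
    rw [le_div_iff₀ hs2, ← abs_of_pos hs2, ← abs_mul, Finset.sum_mul]
    refine le_of_eq_of_le (congrArg _ (Finset.sum_congr rfl fun k _ => ?_)) this
    rw [mul_comm s]; ring

end PartLattice

section PartSine

theorem cos_tele (θ : ℝ) (N : ℕ) :
    2 * Real.sin (θ / 2) * ∑ k ∈ Finset.Icc 1 N, Real.cos (k * θ) =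
      Real.sin (N * θ + θ / 2) - Real.sin (θ / 2) := by
  induction N with
  | zero => simp
  | succ N ih =>
    rw [Finset.sum_Icc_succ_top (by omega), mul_add, ih]
    have e1 : (N : ℝ) * θ + θ / 2 = (N + 1) * θ - θ / 2 := by ring
    push_cast
    rw [e1, Real.sin_sub, Real.sin_add]; ring

theorem cos_sum (n : ℕ) (hn : 0 < n) (a : ℤ) :
    ∑ k ∈ Finset.Icc 1 (n - 1), Real.cos (k * (Real.pi * a / n)) =
      (if (2 * n : ℤ) ∣ a then (n : ℝ) else 0) - (1 + Real.cos (Real.pi * a)) / 2 := by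
  have hn0 : (n : ℝ) ≠ 0 := by positivity
  split_ifs with h
  · obtain ⟨c, rfl⟩ := h
    have : ∀ k ∈ Finset.Icc 1 (n - 1),
        Real.cos (k * (Real.pi * ((2 * n * c : ℤ) : ℝ) / n)) = 1 := by
      intro k _
      have e : (k : ℝ) * (Real.pi * ((2 * n * c : ℤ) : ℝ) / n) = ((k * c : ℤ) : ℝ) * (2 * Real.pi) := by
        push_cast; field_simp
      rw [e, Real.cos_int_mul_two_pi]
    rw [Finset.sum_congr rfl this]
    have e2 : Real.pi * ((2 * n * c : ℤ) : ℝ) = ((n * c : ℤ) : ℝ) * (2 * Real.pi) := by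
      push_cast; ring
    rw [e2, Real.cos_int_mul_two_pi]
    simp [Nat.cast_sub (show 1 ≤ n from hn)]
  · set θ := Real.pi * a / n with hθ
    have hs : Real.sin (θ / 2) ≠ 0 := by
      intro h0
      rw [Real.sin_eq_zero_iff] at h0
      obtain ⟨c, hc⟩ := h0
      apply h
      refine ⟨c, ?_⟩
      have hpi := Real.pi_ne_zero
      have : (a : ℝ) = 2 * n * c := by
        rw [hθ] at hc
        field_simp at hc
        linarith
      exact_mod_cast this
    have t := cos_tele θ (n - 1)
    have e : ((n - 1 : ℕ) : ℝ) * θ + θ / 2 = Real.pi * a - θ / 2 := by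
      rw [Nat.cast_sub hn, hθ]; push_cast; field_simp; ring
    have s0 : Real.sin (Real.pi * a) = 0 := by rw [mul_comm]; exact Real.sin_int_mul_pi a
    rw [e, Real.sin_sub, s0] at t
    have t2 : Real.sin (θ / 2) * (∑ k ∈ Finset.Icc 1 (n - 1), Real.cos (k * θ)) =
        Real.sin (θ / 2) * (0 - (1 + Real.cos (Real.pi * a)) / 2) := by linarith
    exact mul_left_cancel₀ hs t2

theorem sine_orth (n : ℕ) (hn : 0 < n) (j : ℕ) (z : ℤ) :
    ∑ k ∈ Finset.Icc 1 (n - 1), 1 / (n : ℝ) * (phiF k ((j : ℝ) / n) * phiF k ((z : ℝ) / n)) =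
      (if (2 * n : ℤ) ∣ (j - z) then (1 : ℝ) else 0) -
        (if (2 * n : ℤ) ∣ (j + z) then (1 : ℝ) else 0) := by
  have hn0 : (n : ℝ) ≠ 0 := by positivity
  have h2 : Real.sqrt 2 * Real.sqrt 2 = 2 := Real.mul_self_sqrt (by norm_num)
  have e : ∀ k ∈ Finset.Icc 1 (n - 1),
      1 / (n : ℝ) * (phiF k ((j : ℝ) / n) * phiF k ((z : ℝ) / n)) =
      1 / (n : ℝ) * (Real.cos (k * (Real.pi * ((j - z : ℤ) : ℝ) / n)) -
        Real.cos (k * (Real.pi * ((j + z : ℤ) : ℝ) / n))) := by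
    intro k _
    have e1 : (k : ℝ) * (Real.pi * ((j - z : ℤ) : ℝ) / n) =
      k * Real.pi * (j / n) - k * Real.pi * (z / n) := by push_cast; ring
    have e2 : (k : ℝ) * (Real.pi * ((j + z : ℤ) : ℝ) / n) =
      k * Real.pi * (j / n) + k * Real.pi * (z / n) := by push_cast; ring
    rw [e1, e2, Real.cos_sub, Real.cos_add]
    simp only [phiF]
    congr 1
    linear_combination (Real.sin (k * Real.pi * (j / n)) * Real.sin (k * Real.pi * (z / n))) * h2
  rw [Finset.sum_congr rfl e, ← Finset.mul_sum, Finset.sum_sub_distrib, cos_sum n hn, cos_sum n hn]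
  have e3 : Real.pi * ((j - z : ℤ) : ℝ) = Real.pi * ((j + z : ℤ) : ℝ) - z * (2 * Real.pi) := by
    push_cast; ring
  rw [e3, Real.cos_sub_int_mul_two_pi]
  split_ifs <;> field_simp <;> ring

theorem sine_orth_sum (n : ℕ) (hn : 0 < n) (z : ℤ) :
    ∑ j ∈ Finset.Icc 1 (n - 1),
      |∑ k ∈ Finset.Icc 1 (n - 1), 1 / (n : ℝ) * (phiF k ((j : ℝ) / n) * phiF k ((z : ℝ) / n))|
      ≤ 1 := by
  simp only [sine_orth n hn]
  calc _ ≤ ∑ j ∈ Finset.Icc 1 (n - 1),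
        (if (2 * n : ℤ) ∣ ((j : ℤ) - z) ∨ (2 * n : ℤ) ∣ ((j : ℤ) + z) then (1 : ℝ) else 0) := by
        refine Finset.sum_le_sum fun j _ => ?_
        by_cases h1 : (2 * n : ℤ) ∣ ((j : ℤ) - z) <;> by_cases h2 : (2 * n : ℤ) ∣ ((j : ℤ) + z) <;>
          simp [h1, h2]
    _ ≤ 1 := by
        rw [Finset.sum_boole]
        have : (Finset.filter (fun j : ℕ => (2 * n : ℤ) ∣ ((j : ℤ) - z) ∨ (2 * n : ℤ) ∣ ((j : ℤ) + z))
          (Finset.Icc 1 (n - 1))).card ≤ 1 := by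
          rw [Finset.card_le_one]
          have small : ∀ b : ℤ, (2 * n : ℤ) ∣ b → |b| < 2 * n → b = 0 := fun b h1 h2 =>
            Int.eq_zero_of_abs_lt_dvd h1 h2
          intro a ha b hb
          rw [Finset.mem_filter, Finset.mem_Icc] at ha hb
          obtain ⟨⟨a1, a2⟩, a3⟩ := ha
          obtain ⟨⟨b1, b2⟩, b3⟩ := hb
          have A2 : a + 1 ≤ n := by omega
          have B2 : b + 1 ≤ n := by omega
          have d1 : (2 * n : ℤ) ∣ ((a : ℤ) - b) → a = b := by
            intro h
            have := small _ h (by rw [abs_lt]; constructor <;> omega)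
            omega
          have d2 : (2 * n : ℤ) ∣ ((a : ℤ) + b) → a = b := by
            intro h
            have := small _ h (by rw [abs_lt]; constructor <;> omega)
            omega
          rcases a3 with a3 | a3 <;> rcases b3 with b3 | b3
          · exact d1 (by have := dvd_sub a3 b3; ring_nf at this ⊢; exact this)
          · exact d2 (by have := dvd_add a3 b3; ring_nf at this ⊢; exact this)
          · exact d2 (by have := dvd_add a3 b3; ring_nf at this ⊢; exact this)
          · exact d1 (by have := dvd_sub a3 b3; ring_nf at this ⊢; exact this)
        exact_mod_cast this

theorem dual_bound {d : ℕ} (n : ℕ) (hn : 0 < n) (f : (Fin d → ℕ) → ℝ) (hf : ∀ j, |f j| ≤ 1)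
    (z : Fin d → ℤ) :
    |∑ k ∈ Finset.Icc (fun _ : Fin d => 1) (fun _ : Fin d => n - 1),
      (∑ j ∈ Finset.Icc (fun _ : Fin d => 1) (fun _ : Fin d => n - 1),
        (1 / (n : ℝ)) ^ d * (f j * psiL n k (fun i => (j i : ℤ)))) * psiL n k z| ≤ 1 := by
  have e : ∑ k ∈ Finset.Icc (fun _ : Fin d => 1) (fun _ : Fin d => n - 1),
      (∑ j ∈ Finset.Icc (fun _ : Fin d => 1) (fun _ : Fin d => n - 1),
        (1 / (n : ℝ)) ^ d * (f j * psiL n k (fun i => (j i : ℤ)))) * psiL n k z =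
      ∑ j ∈ Finset.Icc (fun _ : Fin d => 1) (fun _ : Fin d => n - 1),
        f j * ∏ i, ∑ k ∈ Finset.Icc 1 (n - 1),
          1 / (n : ℝ) * (phiF k ((j i : ℝ) / n) * phiF k ((z i : ℝ) / n)) := by
    simp only [Finset.sum_mul]
    rw [Finset.sum_comm]
    refine Finset.sum_congr rfl fun j _ => ?_
    rw [Finset.prod_univ_sum, Pi.Icc_eq, Finset.mul_sum]
    refine Finset.sum_congr rfl fun k _ => ?_
    rw [Finset.prod_mul_distrib, Finset.prod_mul_distrib, psiL_apply, psiL_apply]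
    simp only [Finset.prod_const, Finset.card_univ, Fintype.card_fin, Int.cast_natCast]
    ring
  rw [e]
  calc _ ≤ ∑ j ∈ Finset.Icc (fun _ : Fin d => 1) (fun _ : Fin d => n - 1),
        ∏ i, |∑ k ∈ Finset.Icc 1 (n - 1),
          1 / (n : ℝ) * (phiF k ((j i : ℝ) / n) * phiF k ((z i : ℝ) / n))| := by
        refine (Finset.abs_sum_le_sum_abs _ _).trans (Finset.sum_le_sum fun j _ => ?_)
        rw [abs_mul, Finset.abs_prod]
        exact mul_le_of_le_one_left (Finset.prod_nonneg fun _ _ => abs_nonneg _) (hf j)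
    _ = ∏ i, ∑ j ∈ Finset.Icc 1 (n - 1), |∑ k ∈ Finset.Icc 1 (n - 1),
          1 / (n : ℝ) * (phiF k ((j : ℝ) / n) * phiF k ((z i : ℝ) / n))| := by
        rw [Finset.prod_univ_sum, Pi.Icc_eq]
    _ ≤ 1 := Finset.prod_le_one (fun i _ => Finset.sum_nonneg fun _ _ => abs_nonneg _)
        fun i _ => sine_orth_sum n hn (z i)

/-- multilinear interpolation functional -/
noncomputable def interpL {d : ℕ} (n : ℕ) (x : Fin d → ℝ) : LatE d →ₗ[ℝ] ℝ where
  toFun F := ∑ e : Fin d → Bool, (∏ i, (if e i then (n : ℝ) * x i - (⌊(n : ℝ) * x i⌋ : ℝ) else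
    1 - ((n : ℝ) * x i - (⌊(n : ℝ) * x i⌋ : ℝ)))) *
      F (fun i => ⌊(n : ℝ) * x i⌋ + (if e i then 1 else 0))
  map_add' F H := by
    rw [← Finset.sum_add_distrib]
    refine Finset.sum_congr rfl fun e _ => ?_
    rw [BoundedContinuousFunction.add_apply, mul_add]
  map_smul' c F := by
    rw [RingHom.id_apply, smul_eq_mul, Finset.mul_sum]
    refine Finset.sum_congr rfl fun e _ => ?_
    rw [BoundedContinuousFunction.smul_apply, smul_eq_mul]; ring

theorem interpL_apply {d : ℕ} (n : ℕ) (x : Fin d → ℝ) (F : LatE d) :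
    interpL n x F = ∑ e : Fin d → Bool,
     (∏ i, (if e i then (n : ℝ) * x i - (⌊(n : ℝ) * x i⌋ : ℝ) else
      1 - ((n : ℝ) * x i - (⌊(n : ℝ) * x i⌋ : ℝ)))) *
      F (fun i => ⌊(n : ℝ) * x i⌋ + (if e i then 1 else 0)) := rfl

theorem interpL_le {d : ℕ} (n : ℕ) (x : Fin d → ℝ) (F : LatE d) : |interpL n x F| ≤ ‖F‖ := by
  rw [interpL_apply]
  calc _ ≤ ∑ e : Fin d → Bool,
     (∏ i, (if e i then (n : ℝ) * x i - (⌊(n : ℝ) * x i⌋ : ℝ) else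
      1 - ((n : ℝ) * x i - (⌊(n : ℝ) * x i⌋ : ℝ)))) * ‖F‖ := by
        refine (Finset.abs_sum_le_sum_abs _ _).trans (Finset.sum_le_sum fun e _ => ?_)
        have h0 : 0 ≤ ∏ i, (if e i then (n : ℝ) * x i - (⌊(n : ℝ) * x i⌋ : ℝ) else
            1 - ((n : ℝ) * x i - (⌊(n : ℝ) * x i⌋ : ℝ))) := by
          refine Finset.prod_nonneg fun i _ => ?_
          have := Int.floor_le ((n : ℝ) * x i)
          have := Int.lt_floor_add_one ((n : ℝ) * x i)
          split_ifs <;> linarith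
        rw [abs_mul, abs_of_nonneg h0]
        gcongr
        exact F.norm_coe_le_norm _
    _ = (∏ i : Fin d, ∑ b : Bool, (if b then (n : ℝ) * x i - (⌊(n : ℝ) * x i⌋ : ℝ) else
      1 - ((n : ℝ) * x i - (⌊(n : ℝ) * x i⌋ : ℝ)))) * ‖F‖ := by
        rw [← Finset.sum_mul, Finset.prod_univ_sum, Fintype.piFinset_univ]
    _ = ‖F‖ := by simp

theorem interpL_psi {d : ℕ} (n : ℕ) (x : Fin d → ℝ) (k : Fin d → ℕ) :
    interpL n x (psiL n k) = ∏ i, phiLin n (k i) (x i) := by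
  rw [interpL_apply]
  have : ∀ i, phiLin n (k i) (x i) = ∑ b : Bool,
      (if b then (n : ℝ) * x i - (⌊(n : ℝ) * x i⌋ : ℝ) else
      1 - ((n : ℝ) * x i - (⌊(n : ℝ) * x i⌋ : ℝ))) *
        phiF (k i) (((⌊(n : ℝ) * x i⌋ + (if b then 1 else 0) : ℤ) : ℝ) / n) := by
    intro i
    simp only [phiLin, Fintype.sum_bool]
    simp
    ring
  simp only [this]
  rw [Finset.prod_univ_sum, Fintype.piFinset_univ]
  refine Finset.sum_congr rfl fun e _ => ?_
  rw [Finset.prod_mul_distrib, psiL_apply]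

end PartSine

section PartFinal

theorem measurable_floor_coord {d : ℕ} (n : ℕ) (i : Fin d) :
    Measurable (fun y : EuclideanSpace ℝ (Fin d) => ⌊(n : ℝ) * y i⌋) := by
  refine Int.measurable_floor.comp ?_
  have : Measurable (fun y : EuclideanSpace ℝ (Fin d) => y i) := by fun_prop
  exact this.const_mul _

/-- grid cell -/
def cellS {d : ℕ} (n : ℕ) (j : Fin d → ℕ) : Set (EuclideanSpace ℝ (Fin d)) :=
  {y | ∀ i, ⌊(n : ℝ) * y i⌋ = (j i : ℤ)}

theorem measurableSet_cellS {d : ℕ} (n : ℕ) (j : Fin d → ℕ) :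
    MeasurableSet (cellS n j) := by
  have : cellS n j = ⋂ i, (fun y : EuclideanSpace ℝ (Fin d) => ⌊(n : ℝ) * y i⌋) ⁻¹' {(j i : ℤ)} := by
    ext y; simp [cellS]
  rw [this]
  exact MeasurableSet.iInter fun i => measurable_floor_coord n i (measurableSet_singleton _)

theorem volume_cellS {d : ℕ} (n : ℕ) (hn : 0 < n) (j : Fin d → ℕ) :
    volume (cellS n j) = ENNReal.ofReal ((1 / (n : ℝ)) ^ d) := by
  have hn0 : (0 : ℝ) < n := by exact_mod_cast hn
  rw [← (PiLp.volume_preserving_toLp (Fin d)).measure_preimage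
    (measurableSet_cellS n j).nullMeasurableSet]
  have : (WithLp.toLp 2 : (Fin d → ℝ) → EuclideanSpace ℝ (Fin d)) ⁻¹' (cellS n j) =
      Set.univ.pi fun i => Set.Ico ((j i : ℝ) / n) (((j i : ℝ) + 1) / n) := by
    ext y
    simp only [cellS, Set.mem_preimage, Set.mem_ofPred_eq, Set.mem_pi, Set.mem_univ, true_imp_iff,
      Set.mem_Ico]
    refine forall_congr' fun i => ?_
    rw [Int.floor_eq_iff, div_le_iff₀ hn0, lt_div_iff₀ hn0, mul_comm (n : ℝ)]
    simp
  rw [this, Real.volume_pi_Ico]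
  have e : ∀ i : Fin d, ((j i : ℝ) + 1) / n - (j i : ℝ) / n = 1 / n := fun i => by ring
  simp only [e]
  rw [Finset.prod_const, Finset.card_univ, Fintype.card_fin, ENNReal.ofReal_pow (by positivity)]

theorem measurableSet_Q (d : ℕ) : MeasurableSet (Q d) := by
  have : Q d = ⋂ i, (fun y : EuclideanSpace ℝ (Fin d) => y i) ⁻¹' Set.Icc (0:ℝ) 1 := by
    ext y; simp [Q]
  rw [this]
  refine MeasurableSet.iInter fun i => ?_
  have : Measurable (fun y : EuclideanSpace ℝ (Fin d) => y i) := by fun_prop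
  exact this measurableSet_Icc

theorem cell_integral {d : ℕ} (n : ℕ) (hn : 0 < n) (K : EuclideanSpace ℝ (Fin d) → ℝ)
    (H : (Fin d → ℤ) → ℝ) (hK : ∀ y, K y = H (fun i => ⌊(n : ℝ) * y i⌋))
    (hH : ∀ z : Fin d → ℤ, (∃ i, z i = 0 ∨ z i = n) → H z = 0) :
    ∫ y in Q d, |K y| ≤ ∑ j ∈ Finset.Icc (fun _ : Fin d => 1) (fun _ : Fin d => n - 1),
      (1 / (n : ℝ)) ^ d * |H (fun i => (j i : ℤ))| := by
  have hn0 : (0 : ℝ) < n := by exact_mod_cast hn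
  set P := Finset.Icc (fun _ : Fin d => 1) (fun _ : Fin d => n - 1) with hP
  set g : EuclideanSpace ℝ (Fin d) → ℝ := fun y =>
    ∑ j ∈ P, (cellS n j).indicator (fun _ => |H (fun i => (j i : ℤ))|) y with hg
  have ii : ∀ j ∈ P, Integrable ((cellS n j).indicator (fun _ => |H (fun i => (j i : ℤ))|)) := by
    intro j _
    refine (integrable_indicator_iff (measurableSet_cellS n j)).2 ?_
    refine integrableOn_const (by rw [volume_cellS n hn j]; exact ENNReal.ofReal_ne_top)
  have gi : Integrable g := integrable_finsetSum _ ii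
  have g0 : ∀ y, 0 ≤ g y := fun y => Finset.sum_nonneg fun j _ =>
    Set.indicator_nonneg (fun _ _ => abs_nonneg _) _
  calc ∫ y in Q d, |K y| ≤ ∫ y in Q d, g y := by
        refine integral_mono_of_nonneg (ae_of_all _ fun y => abs_nonneg _) gi.integrableOn ?_
        refine ae_restrict_of_forall_mem (measurableSet_Q d) fun y hy => ?_
        by_cases hz : ∃ i, ⌊(n : ℝ) * y i⌋ = 0 ∨ ⌊(n : ℝ) * y i⌋ = n
        · have : K y = 0 := by rw [hK]; exact hH _ hz
          simp only [this, abs_zero]; exact g0 y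
        · push Not at hz
          have b : ∀ i, 0 ≤ ⌊(n : ℝ) * y i⌋ ∧ ⌊(n : ℝ) * y i⌋ ≤ n := by
            intro i
            have := hy i
            constructor
            · exact Int.floor_nonneg.2 (mul_nonneg hn0.le this.1)
            · have h1 : (n : ℝ) * y i ≤ n := mul_le_of_le_one_right hn0.le this.2
              have := Int.floor_le_floor h1
              simpa using this
          set j : Fin d → ℕ := fun i => ⌊(n : ℝ) * y i⌋.toNat with hj
          have hj2 : ∀ i, (j i : ℤ) = ⌊(n : ℝ) * y i⌋ := fun i => Int.toNat_of_nonneg (b i).1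
          have hjP : j ∈ P := by
            rw [hP, Finset.mem_Icc]
            constructor <;> intro i <;> have h1 := hz i <;> have h2 := b i <;> have h3 := hj2 i
            · change 1 ≤ j i; omega
            · change j i ≤ n - 1; omega
          have hcell : y ∈ cellS n j := fun i => (hj2 i).symm
          have e : |K y| = (cellS n j).indicator (fun _ => |H (fun i => (j i : ℤ))|) y := by
            rw [Set.indicator_of_mem hcell, hK]
            congr 2
            ext i; exact (hj2 i).symm
          change |K y| ≤ g y
          rw [e]
          exact Finset.single_le_sum (f := fun j =>
            (cellS n j).indicator (fun _ => |H (fun i => (j i : ℤ))|) y)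
            (fun j _ => Set.indicator_nonneg (fun _ _ => abs_nonneg _) _) hjP
    _ ≤ ∫ y, g y := setIntegral_le_integral gi (ae_of_all _ g0)
    _ = _ := by
        rw [hg, integral_finsetSum _ ii]
        refine Finset.sum_congr rfl fun j _ => ?_
        rw [integral_indicator_const _ (measurableSet_cellS n j), Measure.real, volume_cellS n hn j,
          ENNReal.toReal_ofReal (by positivity), smul_eq_mul]

theorem lamn_nonpos (n j : ℕ) : lamn n j ≤ 0 := by
  rw [lamn]
  have : 0 ≤ (n : ℝ) ^ 2 * Real.sin ((j : ℝ) * Real.pi / (2 * n)) ^ 2 := by positivity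
  linarith

theorem psiL_zero {d : ℕ} (n : ℕ) (hn : 0 < n) (k : Fin d → ℕ) (z : Fin d → ℤ)
    (h : ∃ i, z i = 0 ∨ z i = n) : psiL n k z = 0 := by
  have hn0 : (n : ℝ) ≠ 0 := by positivity
  obtain ⟨i, hi⟩ := h
  rw [psiL_apply]
  refine Finset.prod_eq_zero (Finset.mem_univ i) ?_
  rcases hi with hi | hi
  · rw [hi]; simp [phiF]
  · rw [hi, phiF]
    have : ((n : ℤ) : ℝ) / n = 1 := by push_cast; field_simp
    rw [this, mul_one, Real.sin_nat_mul_pi, mul_zero]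

theorem diff_eq (d : ℕ) (T : ℝ) (hT : 0 < T) (n m : ℕ) (hm : 1 ≤ m) (t : ℝ)
    (ht : 0 < t) (x y : EuclideanSpace ℝ (Fin d)) :
    Gdn d n t x y - Gdnm d T n m (t + T / m) x y =
      ∑ k ∈ Finset.Icc (fun _ : Fin d => 1) (fun _ : Fin d => n - 1),
        (interpL n (fun i => x i) (psiL n k) *
        (Real.exp ((T / m * ∑ i, lamn n (k i)) * (m * t / T)) -
          ((1 - T / m * ∑ i, lamn n (k i)) ^ (⌊m * t / T⌋₊ + 1))⁻¹)) *
          psiL n k (fun i => ⌊(n : ℝ) * y i⌋) := by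
  have hm0 : (0:ℝ) < m := by exact_mod_cast hm
  have hfl : ⌊(m : ℝ) * (t + T / m) / T⌋ = ((⌊m * t / T⌋₊ + 1 : ℕ) : ℤ) := by
    have e : (m : ℝ) * (t + T / m) / T = m * t / T + 1 := by field_simp
    rw [e, Int.floor_add_one]
    push_cast
    rw [Int.natCast_floor_eq_floor (by positivity)]
  have hG : Gdn d n t x y = ∑ k ∈ Finset.Icc (fun _ : Fin d => 1) (fun _ : Fin d => n - 1),
      ∏ i, (Real.exp (lamn n (k i) * t) * phiLin n (k i) (x i) * phiF (k i) (kappa n (y i))) := by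
    rw [Gdn, Pi.Icc_eq]
    simp only [Gn]
    rw [Finset.prod_univ_sum]
  rw [hG, Gdnm, hfl, ← Finset.sum_sub_distrib]
  refine Finset.sum_congr rfl fun k _ => ?_
  have hp : psiL n k (fun i => ⌊(n : ℝ) * y i⌋) = ∏ i, phiF (k i) (kappa n (y i)) := rfl
  have he : ∏ i, Real.exp (lamn n (k i) * t) =
      Real.exp ((T / m * ∑ i, lamn n (k i)) * (m * t / T)) := by
    rw [← Real.exp_sum, ← Finset.sum_mul]
    congr 1
    field_simp
  rw [interpL_psi, hp, Finset.prod_mul_distrib, Finset.prod_mul_distrib, he, zpow_neg, zpow_natCast]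
  ring

theorem inner_bound (d : ℕ) (T : ℝ) (hT : 0 < T) (n m : ℕ) (hn : 2 ≤ n) (hm : 1 ≤ m)
    (t : ℝ) (ht : 0 < t) (x : EuclideanSpace ℝ (Fin d)) :
    ∫ y in Q d, |Gdn d n t x y - Gdnm d T n m (t + T / m) x y| ≤
      (d + 2 * (4 * (4 * (d:ℝ) ^ 2) + 8 + 4 * d)) / (⌊m * t / T⌋₊ + 1) := by
  have hn1 : 0 < n := by omega
  have hm0 : (0:ℝ) < m := by exact_mod_cast hm
  set P := Finset.Icc (fun _ : Fin d => 1) (fun _ : Fin d => n - 1) with hP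
  set L : LatE d →ₗ[ℝ] ℝ := interpL n (fun i => x i) with hL
  set c : (Fin d → ℕ) → ℝ := fun k =>
    (Real.exp ((T / m * ∑ i, lamn n (k i)) * (m * t / T)) -
          ((1 - T / m * ∑ i, lamn n (k i)) ^ (⌊m * t / T⌋₊ + 1))⁻¹) with hc
  set H : (Fin d → ℤ) → ℝ := fun z => ∑ k ∈ P, (L (psiL n k) * c k) * psiL n k z with hH
  have h1 := cell_integral n hn1
    (fun y => Gdn d n t x y - Gdnm d T n m (t + T / m) x y) H
    (fun y => diff_eq d T hT n m hm t ht x y)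
    (fun z hz => Finset.sum_eq_zero fun k _ => by rw [psiL_zero n hn1 k z hz, mul_zero])
  refine h1.trans ?_
  set f : (Fin d → ℕ) → ℝ := fun j => SignType.sign (H (fun i => (j i : ℤ))) with hf
  have hf1 : ∀ j, |f j| ≤ 1 := by
    intro j
    simp only [hf]
    rcases SignType.sign (H (fun i => (j i : ℤ))) with _ | _ | _ <;> simp
  set b : (Fin d → ℕ) → ℝ := fun k =>
    ∑ j ∈ P, (1 / (n : ℝ)) ^ d * (f j * psiL n k (fun i => (j i : ℤ))) with hb
  have hbb := fun s hs => lattice_bounds n hn1 P b (fun z => dual_bound n hn1 f hf1 z) L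
    (interpL_le n _) (T / m) (by positivity) s hs
  have key := scalar_main P (fun k => b k * L (psiL n k)) (fun k => T / m * ∑ i, lamn n (k i))
    (fun k _ => mul_nonpos_of_nonneg_of_nonpos (by positivity)
      (Finset.sum_nonpos fun i _ => lamn_nonpos n (k i))) d (4 * (d:ℝ) ^ 2) (by positivity)
    (by positivity) (fun s hs => (hbb s hs).1) (fun s hs => (hbb s hs).2.1)
    (fun s hs => (hbb s hs).2.2) ⌊m * t / T⌋₊ (m * t / T) (by positivity)
    (Nat.floor_le (by positivity)) (Nat.lt_floor_add_one _).le
  refine le_trans (le_of_eq ?_) ((le_abs_self _).trans key)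
  have e : ∀ j ∈ P, (1 / (n : ℝ)) ^ d * |H (fun i => (j i : ℤ))| =
      ∑ k ∈ P, ((1 / (n : ℝ)) ^ d * (f j * psiL n k (fun i => (j i : ℤ)))) *
        (L (psiL n k) * c k) := by
    intro j _
    rw [← sign_mul_self (H (fun i => (j i : ℤ)))]
    change _ * (f j * H _) = _
    rw [hH]
    simp only [Finset.mul_sum]
    refine Finset.sum_congr rfl fun k _ => ?_
    ring
  rw [Finset.sum_congr rfl e, Finset.sum_comm]
  refine Finset.sum_congr rfl fun k _ => ?_
  rw [← Finset.sum_mul, ← mul_assoc]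

end PartFinal

/-- time-integrated `L¹` estimate of `(G_d)^n - (G_d)^{n,m}(·+T/m)`. -/
theorem stmt_16 (d : ℕ) (hd : 1 ≤ d) (T : ℝ) (hT : 0 < T) (ν : ℝ) (hν : 0 < ν) :
    ∃ C : ℝ, 0 < C ∧ ∀ n : ℕ, 2 ≤ n → ∀ m : ℕ, 1 ≤ m → ∀ x ∈ Q d,
      (∫ t in (0 : ℝ)..T, ∫ y in Q d,
          |Gdn d n t x y - Gdnm d T n m (t + T / m) x y|)
        ≤ C * (m : ℝ) ^ (-1 + ν) := by
  set C0 : ℝ := (d + 2 * (4 * (4 * (d:ℝ) ^ 2) + 8 + 4 * d)) with hC0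
  have hC0p : 0 < C0 := by positivity
  set η : ℝ := min ν 1 with hη
  have hη0 : 0 < η := lt_min hν one_pos
  have hη1 : η ≤ 1 := min_le_right _ _
  refine ⟨C0 * T / η, by positivity, ?_⟩
  intro n hn m hm x _
  have hm1 : (1:ℝ) ≤ m := by exact_mod_cast hm
  have hm0 : (0:ℝ) < m := by linarith
  have hintg : IntervalIntegrable (fun t : ℝ => C0 * (m / T) ^ (-1 + η) * t ^ (-1 + η)) volume 0 T :=
    (intervalIntegral.intervalIntegrable_rpow' (by linarith)).const_mul _
  have step : (∫ t in (0 : ℝ)..T, ∫ y in Q d,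
          |Gdn d n t x y - Gdnm d T n m (t + T / m) x y|)
      ≤ ∫ t in (0 : ℝ)..T, C0 * (m / T) ^ (-1 + η) * t ^ (-1 + η) := by
    rw [intervalIntegral.integral_of_le hT.le, intervalIntegral.integral_of_le hT.le]
    refine integral_mono_of_nonneg
      (ae_of_all _ fun t => integral_nonneg fun y => abs_nonneg _) hintg.1 ?_
    refine ae_restrict_of_forall_mem measurableSet_Ioc fun t ht => ?_
    have ht0 : 0 < t := ht.1
    refine (inner_bound d T hT n m hn hm t ht0 x).trans ?_
    change C0 / ((⌊m * t / T⌋₊ : ℝ) + 1) ≤ C0 * (m / T) ^ (-1 + η) * t ^ (-1 + η)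
    rw [mul_assoc, ← Real.mul_rpow (by positivity) ht0.le, div_eq_mul_inv]
    gcongr
    have hq : (1:ℝ) ≤ (⌊m * t / T⌋₊ : ℝ) + 1 := by
      linarith [(Nat.cast_nonneg ⌊m * t / T⌋₊ : (0:ℝ) ≤ _)]
    calc ((⌊m * t / T⌋₊ : ℝ) + 1)⁻¹ = ((⌊m * t / T⌋₊ : ℝ) + 1) ^ (-1 : ℝ) := by
          rw [Real.rpow_neg_one]
      _ ≤ ((⌊m * t / T⌋₊ : ℝ) + 1) ^ (-1 + η) :=
          Real.rpow_le_rpow_of_exponent_le hq (by linarith)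
      _ ≤ (m / T * t) ^ (-1 + η) := by
          refine Real.rpow_le_rpow_of_nonpos (by positivity) ?_ (by linarith)
          have := (Nat.lt_floor_add_one (m * t / T)).le
          calc _ = m * t / T := by ring
            _ ≤ _ := this
  refine step.trans ?_
  rw [intervalIntegral.integral_const_mul, integral_rpow (Or.inl (by linarith))]
  have e1 : (-1 + η + 1) = η := by ring
  rw [e1, Real.zero_rpow hη0.ne', sub_zero, Real.div_rpow hm0.le hT.le]
  have e2 : T ^ (-1 + η) * T = T ^ η := by
    rw [← Real.rpow_add_one hT.ne', e1]
  have hTp : 0 < T ^ (-1 + η) := Real.rpow_pos_of_pos hT _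
  calc C0 * ((m:ℝ) ^ (-1 + η) / T ^ (-1 + η)) * (T ^ η / η) = C0 * T / η * (m:ℝ) ^ (-1 + η) := by
        rw [← e2]; field_simp
    _ ≤ C0 * T / η * (m:ℝ) ^ (-1 + ν) := by
        gcongr
        exact min_le_left _ _
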